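/- Let 0 ≤ ε ≤ (53 − 6√71)/23 and set s = √(3ε² − 10ε + 3), ℓ_ε = 2 + 2ε + 2s. Let (x₁, y₁), (x₂, y₂) ∈ ℝ² and suppose (x₁ − (1 + 2s/(1 + ε))·⌊y₁⌋_{(1+ε)/2})_{ℓ_ε} ≥ (x₂ − (1 + 2s/(1 + ε))·⌊y₂⌋_{(1+ε)/2})_{ℓ_ε}. Then the function c_ε(x, y) = (2/s)·(x − (1 + 2s/(1 + ε))·⌊y⌋_{(1+ε)/2})_{ℓ_ε} satisfies |c_ε(x₁ − x₂, y₁ − ⌊y₂⌋_{(1+ε)/2}) − c_ε(0, y₂ − ⌊y₂⌋_{(1+ε)/2})| = |c_ε(x₁, y₁) − c_ε(x₂, y₂)|. -/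

import Mathlib

/-- `⌊t⌋_ℓ = ⌊t/ℓ⌋·ℓ`, the floor of `t` to a multiple of `ℓ`. -/
noncomputable def flr (ℓ t : ℝ) : ℝ := ⌊t / ℓ⌋ * ℓ

/-- `(t)_ℓ = t − ⌊t⌋_ℓ`, the remainder of `t` modulo `ℓ`. -/
noncomputable def frc (ℓ t : ℝ) : ℝ := t - flr ℓ t

/-- Euclidean distance between two points of the plane (given as pairs of reals). -/
noncomputable def euclDist (p q : ℝ × ℝ) : ℝ :=
  Real.sqrt ((p.1 - q.1) ^ 2 + (p.2 - q.2) ^ 2)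

/-- `s = √(3ε² − 10ε + 3)`. -/
noncomputable def sEps (ε : ℝ) : ℝ := Real.sqrt (3 * ε ^ 2 - 10 * ε + 3)

/-- `ℓ_ε = 2 + 2ε + 2s`. -/
noncomputable def lEps (ε : ℝ) : ℝ := 2 + 2 * ε + 2 * sEps ε

/-- The coloring `c_ε(x, y) = (2/s)·(x − (1 + 2s/(1 + ε))·⌊y⌋_{(1+ε)/2})_{ℓ_ε}`. -/
noncomputable def colEps (ε x y : ℝ) : ℝ :=
  (2 / sEps ε) * frc (lEps ε) (x - (1 + 2 * sEps ε / (1 + ε)) * flr ((1 + ε) / 2) y)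

lemma flr_sub_flr {ℓ : ℝ} (hℓ : ℓ ≠ 0) (t u : ℝ) :
    flr ℓ (t - flr ℓ u) = flr ℓ t - flr ℓ u := by
  unfold flr
  rw [sub_div, mul_div_cancel_right₀ _ hℓ, Int.floor_sub_intCast]
  push_cast
  ring

lemma frc_eq_fract_mul {ℓ : ℝ} (hℓ : ℓ ≠ 0) (t : ℝ) : frc ℓ t = Int.fract (t / ℓ) * ℓ := by
  rw [frc, flr, ← Int.self_sub_floor, sub_mul, div_mul_cancel₀ _ hℓ]

lemma frc_sub_of_le {ℓ : ℝ} (hℓ : 0 < ℓ) {t u : ℝ} (h : frc ℓ u ≤ frc ℓ t) :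
    frc ℓ (t - u) = frc ℓ t - frc ℓ u := by
  simp only [frc_eq_fract_mul hℓ.ne'] at h ⊢
  have hle := le_of_mul_le_mul_right h hℓ
  rw [← sub_mul, Int.fract_eq_iff.2 ⟨sub_nonneg.2 hle, ?_, ⌊t / ℓ⌋ - ⌊u / ℓ⌋, ?_⟩]
  · linarith [Int.fract_lt_one (t / ℓ), Int.fract_nonneg (u / ℓ)]
  · push_cast [← Int.self_sub_floor]
    ring

/-- Translation invariance of `c_ε`-color differences under shifting by
`(x₂, ⌊y₂⌋_{(1+ε)/2})`. -/
theorem colEps_diff_translation (ε : ℝ) (hε0 : 0 ≤ ε)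
    (hε1 : ε ≤ (53 - 6 * Real.sqrt 71) / 23) (x₁ y₁ x₂ y₂ : ℝ)
    (h : frc (lEps ε) (x₁ - (1 + 2 * sEps ε / (1 + ε)) * flr ((1 + ε) / 2) y₁) ≥
         frc (lEps ε) (x₂ - (1 + 2 * sEps ε / (1 + ε)) * flr ((1 + ε) / 2) y₂)) :
    |colEps ε (x₁ - x₂) (y₁ - flr ((1 + ε) / 2) y₂) -
        colEps ε 0 (y₂ - flr ((1 + ε) / 2) y₂)| =
      |colEps ε x₁ y₁ - colEps ε x₂ y₂| := by
  have hw : (1 + ε) / 2 ≠ 0 := by positivity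
  have hℓ : 0 < lEps ε := by
    have : 0 ≤ sEps ε := Real.sqrt_nonneg _
    unfold lEps
    positivity
  have hzero : frc (lEps ε) 0 = 0 := by simp [frc, flr]
  simp only [colEps, flr_sub_flr hw, sub_self, mul_zero, hzero, sub_zero]
  rw [← mul_sub, ← frc_sub_of_le hℓ h]
  ring_nf
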